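/- Let p be a prime and let L/K be a finite Galois extension of fields with Galois group Γ whose order is coprime to p. Then the natural map Kˣ/(Kˣ)ᵖ → (Lˣ/(Lˣ)ᵖ)^Γ induced by the inclusion K ⊆ L is an isomorphism, where Γ acts on Lˣ/(Lˣ)ᵖ through its action on L. -/

import Mathlib

/-- The map `Rˣ/(Rˣ)ᵖ → Sˣ/(Sˣ)ᵖ` induced by a ring homomorphism `f : R → S`. -/
noncomputable def unitsModPthPowersMap {R S : Type*} [CommRing R] [CommRing S]
    (f : R →+* S) (p : ℕ) :
    Rˣ ⧸ (powMonoidHom p : Rˣ →* Rˣ).range →* Sˣ ⧸ (powMonoidHom p : Sˣ →* Sˣ).range :=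
  QuotientGroup.map _ _ (Units.map f.toMonoidHom)
    (by
      rintro x ⟨y, rfl⟩
      exact ⟨Units.map f.toMonoidHom y, by simp [powMonoidHom]⟩)

theorem unitsModPthPowersMap_mk {R S : Type*} [CommRing R] [CommRing S]
    (f : R →+* S) (p : ℕ) (u : Rˣ) :
    unitsModPthPowersMap f p (QuotientGroup.mk u) =
      QuotientGroup.mk (Units.map f.toMonoidHom u) :=
  rfl

theorem quotient_pthPowers_pow_eq_one {G : Type*} [CommGroup G] (p : ℕ)
    (x : G ⧸ (powMonoidHom p : G →* G).range) : x ^ p = 1 := by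
  obtain ⟨g, rfl⟩ := QuotientGroup.mk_surjective x
  rw [← QuotientGroup.mk_pow, QuotientGroup.eq_one_iff]
  exact ⟨g, rfl⟩

/-- Raising to a power coprime to `p` is invertible on `G/Gᵖ`. -/
theorem quotient_pthPowers_exists_pow_eq_self {G : Type*} [CommGroup G] {n p : ℕ}
    (h : n.Coprime p) (x : G ⧸ (powMonoidHom p : G →* G).range) :
    ∃ m : ℕ, (x ^ n) ^ m = x :=
  exists_pow_eq_self_of_coprime <|
    h.coprime_dvd_right (orderOf_dvd_of_pow_eq_one (quotient_pthPowers_pow_eq_one p x))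

/-- The norm of a unit whose class modulo `p`-th powers is Galois-invariant has the class of
the `[L : K]`-th power of that unit. -/
theorem unitsModPthPowersMap_norm_eq_pow {K L : Type*} [Field K] [Field L] [Algebra K L]
    [FiniteDimensional K L] [IsGalois K L] (p : ℕ) (y : Lˣ)
    (hy : ∀ σ : L ≃ₐ[K] L, unitsModPthPowersMap (σ : L →+* L) p (QuotientGroup.mk y) =
      QuotientGroup.mk y) :
    unitsModPthPowersMap (algebraMap K L) p (QuotientGroup.mk (Units.map (Algebra.norm K) y)) =
      QuotientGroup.mk y ^ Nat.card (L ≃ₐ[K] L) := by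
  have hprod : Units.map (algebraMap K L).toMonoidHom (Units.map (Algebra.norm K) y) =
      ∏ σ : L ≃ₐ[K] L, Units.map (σ : L →+* L).toMonoidHom y := by
    ext
    simp [Algebra.norm_eq_prod_automorphisms, Units.coe_prod]
  rw [unitsModPthPowersMap_mk, hprod, ← QuotientGroup.mk'_apply, map_prod]
  simp only [QuotientGroup.mk'_apply, ← unitsModPthPowersMap_mk, hy]
  rw [Finset.prod_const, Finset.card_univ, Nat.card_eq_fintype_card]

/-- Let `p` be a prime and `L/K` a finite Galois extension whose Galois group `Γ` has order
coprime to `p`.  Then the natural map `Kˣ/(Kˣ)ᵖ → (Lˣ/(Lˣ)ᵖ)^Γ` is an isomorphism: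
the map `Kˣ/(Kˣ)ᵖ → Lˣ/(Lˣ)ᵖ` is injective and its image is exactly the set of
`Γ`-fixed classes. -/
theorem units_mod_pth_powers_galois_descent
    (p : ℕ) (hp : p.Prime) (K L : Type*) [Field K] [Field L] [Algebra K L]
    [FiniteDimensional K L] [IsGalois K L]
    (hcop : Nat.Coprime (Nat.card (L ≃ₐ[K] L)) p) :
    Function.Injective (unitsModPthPowersMap (algebraMap K L) p) ∧
      Set.range (unitsModPthPowersMap (algebraMap K L) p) =
        {x | ∀ σ : L ≃ₐ[K] L, unitsModPthPowersMap (σ : L →+* L) p x = x} := by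
  refine ⟨(injective_iff_map_eq_one _).2 fun x hx ↦ ?_, Set.Subset.antisymm ?_ fun x hx ↦ ?_⟩
  · obtain ⟨m, hm⟩ := quotient_pthPowers_exists_pow_eq_self hcop x
    obtain ⟨k, rfl⟩ := QuotientGroup.mk_surjective x
    rw [unitsModPthPowersMap_mk, QuotientGroup.eq_one_iff] at hx
    obtain ⟨y, hy⟩ := hx
    have hk : k ^ Nat.card (L ≃ₐ[K] L) = Units.map (Algebra.norm K) y ^ p := by
      rw [← map_pow, ← powMonoidHom_apply p y, hy, IsGalois.card_aut_eq_finrank]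
      ext
      simp [Algebra.norm_algebraMap]
    rw [← hm, ← QuotientGroup.mk_pow, hk, QuotientGroup.mk_pow, quotient_pthPowers_pow_eq_one,
      one_pow]
  · rintro _ ⟨x, rfl⟩ σ
    obtain ⟨k, rfl⟩ := QuotientGroup.mk_surjective x
    simp only [unitsModPthPowersMap_mk]
    congr 1
    ext
    simp
  · obtain ⟨m, hm⟩ := quotient_pthPowers_exists_pow_eq_self hcop x
    obtain ⟨y, rfl⟩ := QuotientGroup.mk_surjective x
    exact ⟨QuotientGroup.mk (Units.map (Algebra.norm K) y) ^ m, by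
      rw [map_pow, unitsModPthPowersMap_norm_eq_pow p y hx, hm]⟩
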